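/- Let A₄ = {(x,y,z,u,v,w) ∈ ℝ⁶ : x² + y² = z⁴, u² + v² = w⁴ and x ≠ 0} (equivalently, the set {(x² + y² − z⁴)² + (u² + v² − w⁴)² = 0} with its intersection with the hyperplane {x = 0} removed). Then LGD(A₄) = ℝ⁶. -/

import Mathlib

open Filter Topology Metric Set

/-- The direction set `D_p(A)` of `A ⊆ ℝⁿ` at `p`: unit vectors `a` for which there is a
sequence in `A \ {p}` converging to `p` whose normalised secants converge to `a`. -/
def dirSet {n : ℕ} (A : Set (EuclideanSpace ℝ (Fin n))) (p : EuclideanSpace ℝ (Fin n)) :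
    Set (EuclideanSpace ℝ (Fin n)) :=
  {a | ‖a‖ = 1 ∧ ∃ x : ℕ → EuclideanSpace ℝ (Fin n),
    (∀ i, x i ∈ A ∧ x i ≠ p) ∧
    Tendsto x atTop (nhds p) ∧
    Tendsto (fun i => (‖x i - p‖)⁻¹ • (x i - p)) atTop (nhds a)}

/-- `D_A(A) = {(p, a) : p ∈ A, a ∈ D_p(A)} ⊆ ℝⁿ × ℝⁿ`. -/
def dirBundle {n : ℕ} (A : Set (EuclideanSpace ℝ (Fin n))) :
    Set (EuclideanSpace ℝ (Fin n) × EuclideanSpace ℝ (Fin n)) :=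
  {pa | pa.1 ∈ A ∧ pa.2 ∈ dirSet A pa.1}

/-- The geometric directional bundle of `A` at `0`:
`GD(A) = {a ∈ S^{n-1} : (0, a) ∈ cl(D_A(A))}`. -/
def GD {n : ℕ} (A : Set (EuclideanSpace ℝ (Fin n))) : Set (EuclideanSpace ℝ (Fin n)) :=
  {a | ((0 : EuclideanSpace ℝ (Fin n)), a) ∈ closure (dirBundle A)}

/-- The half-cone `LGD(A) = {t a : t ≥ 0, a ∈ GD(A)}`. -/
def LGD {n : ℕ} (A : Set (EuclideanSpace ℝ (Fin n))) : Set (EuclideanSpace ℝ (Fin n)) :=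
  {x | ∃ t : ℝ, 0 ≤ t ∧ ∃ a ∈ GD A, x = t • a}


/-- The normalised velocity of a curve in `A` is a direction of `A`. -/
lemma mem_dirSet_of_hasDerivAt {n : ℕ} {A : Set (EuclideanSpace ℝ (Fin n))}
    {γ : ℝ → EuclideanSpace ℝ (Fin n)} {v : EuclideanSpace ℝ (Fin n)}
    (hγ : HasDerivAt γ v 0) (hv : v ≠ 0) (hA : ∀ᶠ t in 𝓝 (0 : ℝ), γ t ∈ A) :
    ‖v‖⁻¹ • v ∈ dirSet A (γ 0) := by
  have hne : ∀ᶠ t in 𝓝[>] (0 : ℝ), γ t ∈ A ∧ γ t ≠ γ 0 :=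
    (hA.filter_mono nhdsWithin_le_nhds).and
      ((hγ.eventually_ne hv).filter_mono (nhdsWithin_mono _ fun _ h => ne_of_gt h))
  have hu : Tendsto (fun i : ℕ => 1 / ((i : ℝ) + 1)) atTop (𝓝[>] 0) :=
    tendsto_nhdsWithin_iff.2
      ⟨tendsto_one_div_add_atTop_nhds_zero_nat, Eventually.of_forall fun i => by
        simp only [mem_Ioi]; positivity⟩
  obtain ⟨N, hN⟩ := eventually_atTop.1 (hu.eventually hne)
  have huN := hu.comp (tendsto_add_atTop_nat N)
  have hlim : Tendsto (fun t => ‖γ t - γ 0‖⁻¹ • (γ t - γ 0)) (𝓝[>] 0) (𝓝 (‖v‖⁻¹ • v)) := by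
    have hs : Tendsto (slope γ 0) (𝓝[>] 0) (𝓝 v) :=
      (hasDerivAt_iff_tendsto_slope.1 hγ).mono_left (nhdsWithin_mono _ fun _ h => ne_of_gt h)
    refine ((hs.norm.inv₀ (norm_ne_zero_iff.2 hv)).smul hs).congr' ?_
    filter_upwards [self_mem_nhdsWithin] with t ht
    have ht : 0 < t := ht
    rw [slope_def_module, sub_zero, norm_smul, smul_smul, norm_inv, Real.norm_of_nonneg ht.le]
    congr 1
    field_simp
  refine ⟨norm_smul_inv_norm hv, fun i => γ (1 / (((i + N : ℕ) : ℝ) + 1)),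
    fun i => hN _ (by omega), ?_, hlim.comp huN⟩
  exact hγ.continuousAt.tendsto.comp (huN.mono_right nhdsWithin_le_nhds)

/-- A nonzero limit of velocities at base points tending to `0` yields an element of `GD A`. -/
lemma mem_GD_of_tendsto {n : ℕ} {A : Set (EuclideanSpace ℝ (Fin n))} {ι : Type*} {l : Filter ι}
    [l.NeBot] {p w : ι → EuclideanSpace ℝ (Fin n)} {v : EuclideanSpace ℝ (Fin n)}
    (hp : Tendsto p l (𝓝 0)) (hw : Tendsto w l (𝓝 v)) (hv : v ≠ 0)
    (h : ∀ᶠ s in l, w s ≠ 0 → p s ∈ A ∧ ‖w s‖⁻¹ • w s ∈ dirSet A (p s)) :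
    ‖v‖⁻¹ • v ∈ GD A := by
  refine mem_closure_of_tendsto
    (hp.prodMk_nhds ((hw.norm.inv₀ (norm_ne_zero_iff.2 hv)).smul hw)) ?_
  filter_upwards [h, hw.eventually_ne hv] with s hs hs' using hs hs'

lemma exists_polar (a b : ℝ) : ∃ r θ : ℝ, a = -(r * Real.sin θ) ∧ b = r * Real.cos θ := by
  refine ⟨‖(⟨b, -a⟩ : ℂ)‖, Complex.arg ⟨b, -a⟩, ?_, ?_⟩
  · rw [Complex.norm_mul_sin_arg]; simp
  · rw [Complex.norm_mul_cos_arg]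

/-- A curve on `A₄` which starts at `(s² cos θ, s² sin θ, s, s² cos φ, s² sin φ, s)`. -/
noncomputable def quarticCurve (s c f k l θ φ t : ℝ) : EuclideanSpace ℝ (Fin 6) :=
  !₂[(s + c * t) ^ 2 * Real.cos (θ + k * t), (s + c * t) ^ 2 * Real.sin (θ + k * t), s + c * t,
    (s + f * t) ^ 2 * Real.cos (φ + l * t), (s + f * t) ^ 2 * Real.sin (φ + l * t), s + f * t]

lemma hasDerivAt_quarticCurve (s c f k l θ φ : ℝ) :
    HasDerivAt (quarticCurve s c f k l θ φ)
      !₂[2 * s * c * Real.cos θ - s ^ 2 * k * Real.sin θ,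
        2 * s * c * Real.sin θ + s ^ 2 * k * Real.cos θ, c,
        2 * s * f * Real.cos φ - s ^ 2 * l * Real.sin φ,
        2 * s * f * Real.sin φ + s ^ 2 * l * Real.cos φ, f] 0 := by
  have hlin (x y : ℝ) : HasDerivAt (fun t : ℝ => x + y * t) y 0 := by
    simpa using ((hasDerivAt_id (0 : ℝ)).const_mul y).const_add x
  have hcos (c k θ : ℝ) : HasDerivAt (fun t : ℝ => (s + c * t) ^ 2 * Real.cos (θ + k * t))
      (2 * s * c * Real.cos θ - s ^ 2 * k * Real.sin θ) 0 := by
    refine (((hlin s c).pow 2).mul (hlin θ k).cos).congr_deriv ?_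
    simp; ring
  have hsin (c k θ : ℝ) : HasDerivAt (fun t : ℝ => (s + c * t) ^ 2 * Real.sin (θ + k * t))
      (2 * s * c * Real.sin θ + s ^ 2 * k * Real.cos θ) 0 := by
    refine (((hlin s c).pow 2).mul (hlin θ k).sin).congr_deriv ?_
    simp; ring
  refine (PiLp.continuousLinearEquiv 2 ℝ (fun _ : Fin 6 => ℝ)).symm.hasFDerivAt.comp_hasDerivAt 0
    (hasDerivAt_pi.2 fun i => ?_)
  fin_cases i
  exacts [hcos c k θ, hsin c k θ, hlin s c, hcos f l φ, hsin f l φ, hlin s f]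

/-- For A₄ = {x² + y² = z⁴, u² + v² = w⁴, x ≠ 0} ⊆ ℝ⁶, LGD(A₄) = ℝ⁶. -/
theorem stmt_11 (A : Set (EuclideanSpace ℝ (Fin 6)))
    (hA : A = {v | (v 0) ^ 2 + (v 1) ^ 2 = (v 2) ^ 4 ∧ (v 3) ^ 2 + (v 4) ^ 2 = (v 5) ^ 4 ∧
                   v 0 ≠ 0}) :
    LGD A = Set.univ := by
  have hcone : ∀ v : EuclideanSpace ℝ (Fin 6), v ≠ 0 → ‖v‖⁻¹ • v ∈ GD A := by
    intro v hv
    choose r θ ha hb using fun s : ℝ => exists_polar (v 0) (v 1 + s)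
    obtain ⟨q, φ, hd, he⟩ := exists_polar (v 3) (v 4)
    have hs : Tendsto (fun s : ℝ => s) (𝓝[≠] 0) (𝓝 0) := nhdsWithin_le_nhds
    have hmul {g : ℝ → ℝ} (hg : ∀ s, |g s| ≤ 1) (c : ℝ) {h : ℝ → ℝ}
        (hh : Tendsto h (𝓝[≠] 0) (𝓝 0)) : Tendsto (fun s => h s * c * g s) (𝓝[≠] 0) (𝓝 0) := by
      refine Tendsto.zero_mul_isBoundedUnder_le (by simpa using hh.mul_const c) ?_
      exact isBoundedUnder_of ⟨1, hg⟩
    have hcos (s : ℝ) : |Real.cos (θ s)| ≤ 1 := Real.abs_cos_le_one _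
    have hsin (s : ℝ) : |Real.sin (θ s)| ≤ 1 := Real.abs_sin_le_one _
    have hs2 : Tendsto (fun s : ℝ => s ^ 2) (𝓝[≠] 0) (𝓝 0) := by simpa using hs.pow 2
    have h2s : Tendsto (fun s : ℝ => 2 * s) (𝓝[≠] 0) (𝓝 0) := by simpa using hs.const_mul 2
    have tends {p : ℝ → EuclideanSpace ℝ (Fin 6)} {x : EuclideanSpace ℝ (Fin 6)}
        (h : ∀ i, Tendsto (fun s => p s i) (𝓝[≠] 0) (𝓝 (x i))) :
        Tendsto p (𝓝[≠] 0) (𝓝 x) :=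
      ((PiLp.continuous_toLp 2 _).tendsto _).comp (tendsto_pi_nhds.2 h)
    let γ (s : ℝ) : ℝ → EuclideanSpace ℝ (Fin 6) :=
      quarticCurve s (v 2) (v 5) (r s / s ^ 2) (q / s ^ 2) (θ s) φ
    let w (s : ℝ) : EuclideanSpace ℝ (Fin 6) :=
      !₂[2 * s * v 2 * Real.cos (θ s) + v 0, 2 * s * v 2 * Real.sin (θ s) + (v 1 + s), v 2,
        2 * s * v 5 * Real.cos φ + v 3, 2 * s * v 5 * Real.sin φ + v 4, v 5]
    refine mem_GD_of_tendsto (l := 𝓝[≠] (0 : ℝ)) (p := fun s => γ s 0) (w := w) ?_ ?_ hv ?_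
    · refine tends fun i => ?_
      fin_cases i
      · simpa [γ, quarticCurve] using hmul hcos 1 hs2
      · simpa [γ, quarticCurve] using hmul hsin 1 hs2
      · simpa [γ, quarticCurve] using hs
      · simpa [γ, quarticCurve] using hs2.mul_const (Real.cos φ)
      · simpa [γ, quarticCurve] using hs2.mul_const (Real.sin φ)
      · simpa [γ, quarticCurve] using hs
    · refine tends fun i => ?_
      fin_cases i
      · simpa [w] using (hmul hcos (v 2) h2s).add_const (v 0)
      · simpa [w] using (hmul hsin (v 2) h2s).add (hs.const_add (v 1))
      · simp [w]
      · simpa [w] using ((h2s.mul_const (v 5)).mul_const (Real.cos φ)).add_const (v 3)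
      · simpa [w] using ((h2s.mul_const (v 5)).mul_const (Real.sin φ)).add_const (v 4)
      · simp [w]
    · have hb0 : ∀ᶠ s in 𝓝[≠] (0 : ℝ), v 1 + s ≠ 0 := by
        by_cases h : v 1 = 0
        · filter_upwards [self_mem_nhdsWithin] with s hs
          simpa [h] using hs
        · exact (hs.const_add (v 1)).eventually_ne (by simpa using h)
      filter_upwards [hb0, self_mem_nhdsWithin] with s hsb (hs0 : s ≠ 0) hw0
      have hderiv : HasDerivAt (γ s) (w s) 0 := by
        convert hasDerivAt_quarticCurve s (v 2) (v 5) (r s / s ^ 2) (q / s ^ 2) (θ s) φ using 1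
        rw [mul_div_cancel₀ _ (pow_ne_zero 2 hs0), mul_div_cancel₀ _ (pow_ne_zero 2 hs0)]
        simp only [w, sub_eq_add_neg, ← ha, ← hb, ← hd, ← he]
      have hc : Real.cos (θ s) ≠ 0 := fun h => hsb (by rw [hb s, h, mul_zero])
      have hmem : ∀ᶠ t in 𝓝 (0 : ℝ), γ s t ∈ A := by
        have h0 : ContinuousAt (fun t => γ s t 0) 0 := by
          simp only [γ, quarticCurve]
          change ContinuousAt (fun t : ℝ =>
            (s + v 2 * t) ^ 2 * Real.cos (θ s + r s / s ^ 2 * t)) 0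
          fun_prop
        filter_upwards [h0.eventually_ne (by simp [γ, quarticCurve, hs0, hc] : γ s 0 0 ≠ 0)] with t ht
        rw [hA]
        refine ⟨?_, ?_, ht⟩
        · simp [γ, quarticCurve]
          linear_combination (s + v 2 * t) ^ 4 * Real.cos_sq_add_sin_sq (θ s + r s / s ^ 2 * t)
        · simp [γ, quarticCurve]
          linear_combination (s + v 5 * t) ^ 4 * Real.cos_sq_add_sin_sq (φ + q / s ^ 2 * t)
      exact ⟨hmem.self_of_nhds, mem_dirSet_of_hasDerivAt hderiv hw0 hmem⟩
  refine eq_univ_of_forall fun x => ?_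
  by_cases hx : x = 0
  · obtain ⟨v, hv⟩ := exists_ne (0 : EuclideanSpace ℝ (Fin 6))
    exact ⟨0, le_rfl, _, hcone v hv, by simp [hx]⟩
  · exact ⟨‖x‖, norm_nonneg x, _, hcone x hx, by
      rw [smul_inv_smul₀ (norm_ne_zero_iff.2 hx)]⟩
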